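/- Let f : ℂ → ℂ be a bounded measurable function with compact support, and define I f(z) := (1/(2πi)) ∫_ℂ f(t) (dt̄ ∧ dt)/(t - z). If f is continuously differentiable, then ∂(I f)/∂z̄ = f (the inhomogeneous Cauchy integral formula / Cauchy–Pompeiu solution of the one-variable ∂̄-equation). -/

import Mathlib

open MeasureTheory

lemma aux_locInt : LocallyIntegrable (fun s : ℂ => -s⁻¹) volume := by
  refine locallyIntegrable_of_norm_le_rpow (C := 1) (α := 1) (by simp) (by simp)
    (Filter.Eventually.of_forall fun s => ?_) (by fun_prop)
  simp [Real.rpow_neg_one]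

noncomputable def auxE (θ : ℝ) : ℂ := Real.cos θ + Real.sin θ * Complex.I

lemma auxE_cont : Continuous auxE := by unfold auxE; fun_prop

lemma auxE_norm (θ : ℝ) : ‖auxE θ‖ = 1 := by
  unfold auxE
  simp [Complex.norm_cos_add_sin_mul_I]

lemma auxE_deriv (θ : ℝ) : HasDerivAt auxE (Complex.I * auxE θ) θ := by
  have h1 := (Real.hasDerivAt_cos θ).ofReal_comp
  have h2 := ((Real.hasDerivAt_sin θ).ofReal_comp).mul_const Complex.I
  refine (h1.add h2).congr_deriv ?_
  unfold auxE
  push_cast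
  linear_combination (-Complex.sin θ) * Complex.I_sq

lemma aux_radius (f : ℂ → ℂ) (hcs : HasCompactSupport f) (z : ℂ) :
    ∃ R : ℝ, 0 < R ∧ ∀ r θ : ℝ, R < r → f (z - r * auxE θ) = 0 ∧
      fderiv ℝ f (z - r * auxE θ) = 0 := by
  obtain ⟨R, hR⟩ := hcs.isCompact.isBounded.subset_closedBall z
  refine ⟨max R 1, by positivity, fun r θ hr => ?_⟩
  have h : z - r * auxE θ ∉ tsupport f := by
    intro h
    have := hR h
    rw [Metric.mem_closedBall, dist_eq_norm] at this
    have h0 : (0:ℝ) < r := lt_trans (by positivity) hr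
    simp [auxE_norm, abs_of_pos h0] at this
    exact absurd (lt_of_le_of_lt (le_max_left R 1) hr) (not_lt.2 this)
  refine ⟨image_eq_zero_of_notMem_tsupport h, ?_⟩
  by_contra h'
  exact h (support_fderiv_subset ℝ h')

lemma aux_integrable (f : ℂ → ℂ) (hcs : HasCompactSupport f) (hf : ContDiff ℝ 1 f) (z : ℂ)
    (v : ℝ → ℂ) (hv : Continuous v) :
    IntegrableOn (fun p : ℝ × ℝ => fderiv ℝ f (z - p.1 * auxE p.2) (v p.2))
      (Set.Ioi 0 ×ˢ Set.Ioo (-Real.pi) Real.pi) := by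
  obtain ⟨R, hR0, hR⟩ := aux_radius f hcs z
  have hc : Continuous (fun p : ℝ × ℝ => fderiv ℝ f (z - p.1 * auxE p.2) (v p.2)) := by
    have := hf.continuous_fderiv one_ne_zero
    have h2 := auxE_cont
    fun_prop
  have hK : IsCompact (Set.Icc (0:ℝ) R ×ˢ Set.Icc (-Real.pi) Real.pi) :=
    isCompact_Icc.prod isCompact_Icc
  refine IntegrableOn.of_forall_sdiff_eq_zero (hc.continuousOn.integrableOn_compact hK)
    (measurableSet_Ioi.prod measurableSet_Ioo) ?_
  rintro ⟨r, θ⟩ ⟨⟨h1, h2⟩, h3⟩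
  have : R < r := by
    by_contra h
    exact h3 ⟨⟨le_of_lt h1, not_lt.1 h⟩, ⟨h2.1.le, h2.2.le⟩⟩
  simp [(hR r θ this).2]

lemma aux_radial (f : ℂ → ℂ) (hcs : HasCompactSupport f) (hf : ContDiff ℝ 1 f) (z : ℂ) (θ : ℝ) :
    ∫ r in Set.Ioi (0:ℝ), fderiv ℝ f (z - r * auxE θ) (auxE θ) = f z := by
  obtain ⟨R, hR0, hR⟩ := aux_radius f hcs z
  have hd : ∀ r : ℝ, HasDerivAt (fun r : ℝ => - f (z - r * auxE θ))
      (fderiv ℝ f (z - r * auxE θ) (auxE θ)) r := by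
    intro r
    have h1 : HasDerivAt (fun r : ℝ => z - r * auxE θ) (-auxE θ) r := by
      have := ((Complex.ofRealCLM.hasDerivAt (x := r)).mul_const (auxE θ)).const_sub z
      simpa using this
    have h2 := ((hf.differentiable one_ne_zero) (z - r * auxE θ)).hasFDerivAt.comp_hasDerivAt r h1
    refine h2.neg.congr_deriv ?_
    simp
  have hc : Continuous (fun r : ℝ => fderiv ℝ f (z - r * auxE θ) (auxE θ)) := by
    have := hf.continuous_fderiv one_ne_zero
    fun_prop
  have hi : IntegrableOn (fun r : ℝ => fderiv ℝ f (z - r * auxE θ) (auxE θ)) (Set.Ioi 0) := by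
    refine IntegrableOn.of_forall_sdiff_eq_zero (hc.integrableOn_Icc (a := 0) (b := R))
      measurableSet_Ioi ?_
    rintro r ⟨h1, h3⟩
    have : R < r := by
      by_contra h
      exact h3 ⟨le_of_lt h1, not_lt.1 h⟩
    simp [(hR r θ this).2]
  have := integral_Ioi_of_hasDerivAt_of_tendsto' (m := 0) (fun r _ => hd r) hi ?_
  · rw [this]; simp
  · refine tendsto_const_nhds.congr' ?_
    filter_upwards [Filter.eventually_gt_atTop R] with r hr
    simp [(hR r θ hr).1]

lemma aux_angular (f : ℂ → ℂ) (hf : ContDiff ℝ 1 f) (z : ℂ) (r : ℝ) (hr : 0 < r) :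
    ∫ θ in Set.Ioo (-Real.pi) Real.pi,
      fderiv ℝ f (z - r * auxE θ) (Complex.I * auxE θ) = 0 := by
  have hd : ∀ θ : ℝ, HasDerivAt (fun θ : ℝ => - (r⁻¹ : ℝ) • f (z - r * auxE θ))
      (fderiv ℝ f (z - r * auxE θ) (Complex.I * auxE θ)) θ := by
    intro θ
    have h1 : HasDerivAt (fun θ : ℝ => z - r * auxE θ) (r • (-(Complex.I * auxE θ))) θ := by
      have := ((auxE_deriv θ).const_mul (r : ℂ)).const_sub z
      simpa using this
    have h2 := ((hf.differentiable one_ne_zero) (z - r * auxE θ)).hasFDerivAt.comp_hasDerivAt θ h1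
    have h3 := h2.const_smul (-(r⁻¹ : ℝ))
    refine h3.congr_deriv ?_
    rw [map_smul, smul_smul, map_neg, neg_mul, inv_mul_cancel₀ hr.ne']
    simp
  have hc : Continuous (fun θ : ℝ => fderiv ℝ f (z - r * auxE θ) (Complex.I * auxE θ)) := by
    have := hf.continuous_fderiv one_ne_zero
    have h2 := auxE_cont
    fun_prop
  rw [← integral_Ioc_eq_integral_Ioo,
    ← intervalIntegral.integral_of_le (by linarith [Real.pi_pos]),
    intervalIntegral.integral_eq_sub_of_hasDerivAt (fun θ _ => hd θ) (hc.intervalIntegrable _ _)]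
  simp [auxE]

lemma aux_main (f : ℂ → ℂ) (hcs : HasCompactSupport f) (hf : ContDiff ℝ 1 f) (z : ℂ) :
    ∫ s : ℂ, s⁻¹ * (fderiv ℝ f (z - s) 1 + Complex.I * fderiv ℝ f (z - s) Complex.I)
      = 2 * Real.pi * f z := by
  rw [← Complex.integral_comp_polarCoord_symm]
  have hA := aux_integrable f hcs hf z auxE auxE_cont
  have hB := aux_integrable f hcs hf z (fun θ => Complex.I * auxE θ)
    (continuous_const.mul auxE_cont)
  have hT : polarCoord.target = Set.Ioi (0:ℝ) ×ˢ Set.Ioo (-Real.pi) Real.pi := rfl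
  rw [hT]
  have key : ∀ p ∈ Set.Ioi (0:ℝ) ×ˢ Set.Ioo (-Real.pi) Real.pi,
      p.1 • ((Complex.polarCoord.symm p)⁻¹ * (fderiv ℝ f (z - Complex.polarCoord.symm p) 1
        + Complex.I * fderiv ℝ f (z - Complex.polarCoord.symm p) Complex.I))
      = fderiv ℝ f (z - p.1 * auxE p.2) (auxE p.2)
        + Complex.I * fderiv ℝ f (z - p.1 * auxE p.2) (Complex.I * auxE p.2) := by
    rintro ⟨r, θ⟩ ⟨hr, -⟩
    have hr' : (r : ℂ) ≠ 0 := by exact_mod_cast (ne_of_gt hr)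
    rw [Complex.polarCoord_symm_apply]
    change r • (((r : ℂ) * auxE θ)⁻¹ * (fderiv ℝ f (z - r * auxE θ) 1
        + Complex.I * fderiv ℝ f (z - r * auxE θ) Complex.I)) = 
        fderiv ℝ f (z - r * auxE θ) (auxE θ)
        + Complex.I * fderiv ℝ f (z - r * auxE θ) (Complex.I * auxE θ)
    generalize fderiv ℝ f (z - r * auxE θ) = D
    have e1 : auxE θ = Real.cos θ • (1:ℂ) + Real.sin θ • Complex.I := by
      simp [auxE]
    have e2 : Complex.I * auxE θ = (-Real.sin θ) • (1:ℂ) + Real.cos θ • Complex.I := by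
      simp only [auxE, Complex.real_smul]; push_cast
      linear_combination (Complex.sin θ) * Complex.I_sq
    have e3 : (auxE θ)⁻¹ = Real.cos θ - Real.sin θ * Complex.I := by
      apply inv_eq_of_mul_eq_one_right
      simp only [auxE]; push_cast
      linear_combination Complex.sin_sq_add_cos_sq θ - (Complex.sin θ)^2 * Complex.I_sq
    rw [e2, mul_inv, e3]
    conv_rhs => rw [e1]
    simp only [map_add, map_smul]
    simp only [Complex.real_smul]
    push_cast
    field_simp
    linear_combination (-Complex.sin θ * D Complex.I) * Complex.I_sq
  rw [setIntegral_congr_fun (measurableSet_Ioi.prod measurableSet_Ioo) key,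
    integral_add hA (hB.const_mul _), integral_const_mul]
  have iB : ∫ p in Set.Ioi (0:ℝ) ×ˢ Set.Ioo (-Real.pi) Real.pi,
      fderiv ℝ f (z - p.1 * auxE p.2) (Complex.I * auxE p.2) = 0 := by
    rw [Measure.volume_eq_prod] at hB ⊢
    rw [setIntegral_prod _ hB]
    exact setIntegral_eq_zero_of_forall_eq_zero fun r hr => aux_angular f hf z r hr
  have iA : ∫ p in Set.Ioi (0:ℝ) ×ˢ Set.Ioo (-Real.pi) Real.pi,
      fderiv ℝ f (z - p.1 * auxE p.2) (auxE p.2) = 2 * Real.pi * f z := by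
    rw [Measure.volume_eq_prod] at hA ⊢
    rw [IntegrableOn, ← Measure.prod_restrict] at hA
    rw [← Measure.prod_restrict, integral_prod_symm _ hA]
    simp only [aux_radial f hcs hf z]
    simp [Real.pi_pos.le, two_mul]
  rw [iA, iB]; simp

/-- The Cauchy transform `I f (z) = (1/(2πi)) ∫ f(t) dt̄∧dt/(t-z)
  = -(1/π) ∫ f(t)/(t-z) dV(t)` of a bounded, compactly supported, continuously
differentiable `f` solves the one-variable `∂̄`-equation: `∂(I f)/∂z̄ = f`,
where `∂/∂z̄ = ½(∂_x + i ∂_y)`. -/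
theorem stmt9 (f : ℂ → ℂ) (hb : ∃ C, ∀ z, ‖f z‖ ≤ C) (hcs : HasCompactSupport f)
    (hf : ContDiff ℝ 1 f) (z : ℂ) :
    (fderiv ℝ (fun w : ℂ => (-(1 / Real.pi) : ℝ) • ∫ t : ℂ, f t / (t - w)) z 1 +
        Complex.I *
          fderiv ℝ (fun w : ℂ => (-(1 / Real.pi) : ℝ) • ∫ t : ℂ, f t / (t - w)) z Complex.I) / 2
      = f z := by
  have h0 : (fun w : ℂ => ∫ t : ℂ, f t / (t - w)) =
      convolution (fun s : ℂ => -s⁻¹) f (ContinuousLinearMap.mul ℝ ℂ) volume := by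
    funext w
    rw [convolution_def, ← integral_sub_left_eq_self _ volume w]
    refine integral_congr_ae (Filter.Eventually.of_forall fun s => ?_)
    simp [div_eq_mul_inv, mul_comm]
  have hD := hcs.hasFDerivAt_convolution_right (ContinuousLinearMap.mul ℝ ℂ) aux_locInt hf z
  rw [← h0] at hD
  have hD' := hD.const_smul (-(1 / Real.pi) : ℝ)
  have hD2 : fderiv ℝ (fun w : ℂ => (-(1 / Real.pi) : ℝ) • ∫ t : ℂ, f t / (t - w)) z = _ :=
    hD'.fderiv
  have hcd := hf.continuous_fderiv one_ne_zero
  rw [hD2]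
  simp only [smul_apply]
  rw [convolution_precompR_apply _ aux_locInt (hcs.fderiv ℝ) hcd,
    convolution_precompR_apply _ aux_locInt (hcs.fderiv ℝ) hcd, convolution_def, convolution_def]
  have hint : ∀ v : ℂ, Integrable (fun s : ℂ => -s⁻¹ * fderiv ℝ f (z - s) v) := by
    intro v
    have := ((hcs.fderiv ℝ).comp_left (g := fun D : ℂ →L[ℝ] ℂ => D v) (by simp)
      ).convolutionExists_right (ContinuousLinearMap.mul ℝ ℂ) aux_locInt (by fun_prop) z
    exact this
  have hm := aux_main f hcs hf z
  have hs : ∫ s : ℂ, s⁻¹ * (fderiv ℝ f (z - s) 1 + Complex.I * fderiv ℝ f (z - s) Complex.I)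
      = -((∫ s : ℂ, -s⁻¹ * fderiv ℝ f (z - s) 1)
        + Complex.I * ∫ s : ℂ, -s⁻¹ * fderiv ℝ f (z - s) Complex.I) := by
    rw [← integral_const_mul, ← integral_add (hint 1) ((hint _).const_mul _), ← integral_neg]
    congr 1; funext s; ring
  rw [hs] at hm
  simp only [ContinuousLinearMap.mul_apply']
  generalize (∫ s : ℂ, -s⁻¹ * fderiv ℝ f (z - s) 1) = a at *
  generalize (∫ s : ℂ, -s⁻¹ * fderiv ℝ f (z - s) Complex.I) = b at *
  have hpi : (Real.pi : ℂ) ≠ 0 := by exact_mod_cast Real.pi_ne_zero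
  simp only [Complex.real_smul]
  push_cast
  field_simp
  linear_combination hm
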